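/- Let (G, λ, s, t) be an instance of Dyck-2 reachability, and let 𝒢 be the context-free grammar with terminal symbols E, nonterminal symbols {⟨u,v⟩ : (u,v) ∈ V × V}, axiom ⟨s,t⟩, and exactly the following productions: ⟨u,v⟩ → ⟨u,w⟩⟨w,v⟩ for all u, v, w ∈ V; ⟨u,v⟩ → e ⟨x,y⟩ f for all edges e = (u,x) ∈ E and f = (y,v) ∈ E with λ(e)λ(f) ∈ {o₁c₁, o₂c₂}; and ⟨u,u⟩ → ε for all u ∈ V. Then for all u, v ∈ V, every valid walk from u to v (viewed as a word over E) is derivable from the nonterminal ⟨u,v⟩ in 𝒢. -/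

import Mathlib

/-- The four-letter alphabet of Dyck-2: two kinds of opening and closing brackets. -/
inductive Sig2 : Type
  | o1 | c1 | o2 | c2
deriving DecidableEq

/-- The Dyck-2 language: the smallest language containing ε and closed under
concatenation and wrapping in either kind of matching brackets. -/
inductive IsDyck : List Sig2 → Prop
  | nil : IsDyck []
  | append {u v : List Sig2} : IsDyck u → IsDyck v → IsDyck (u ++ v)
  | br1 {u : List Sig2} : IsDyck u → IsDyck (Sig2.o1 :: u ++ [Sig2.c1])
  | br2 {u : List Sig2} : IsDyck u → IsDyck (Sig2.o2 :: u ++ [Sig2.c2])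

/-- `IsWalk E u v p` : `p` is a walk from `u` to `v` in the graph with edge set `E`. -/
def IsWalk {V : Type} (E : Set (V × V)) : V → V → List (V × V) → Prop
  | u, v, [] => u = v
  | u, v, e :: p => e ∈ E ∧ e.1 = u ∧ IsWalk E e.2 v p

/-- A walk is valid if its labels form a Dyck-2 word. -/
def IsValidWalk {V : Type} (E : Set (V × V)) (lab : V × V → Sig2) (u v : V)
    (p : List (V × V)) : Prop :=
  IsWalk E u v p ∧ IsDyck (p.map lab)


/-- `FullDerives E lab (u, v) α` : the word `α` over the terminal alphabet `E`
is derivable from the nonterminal `⟨u,v⟩` in the grammar whose productions are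
`⟨u,v⟩ → ⟨u,w⟩⟨w,v⟩` for all `u v w`, `⟨u,v⟩ → e ⟨x,y⟩ f` for all edges
`e = (u,x)` and `f = (y,v)` with matching bracket labels,
and `⟨u,u⟩ → ε` for all `u`. -/
inductive FullDerives {V : Type} (E : Set (V × V)) (lab : V × V → Sig2) :
    V × V → List (V × V) → Prop
  | split {u v : V} (w : V) {α β : List (V × V)} :
      FullDerives E lab (u, w) α → FullDerives E lab (w, v) β →
      FullDerives E lab (u, v) (α ++ β)
  | wrap {u v x y : V} {α : List (V × V)} :
      (u, x) ∈ E → (y, v) ∈ E →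
      ((lab (u, x) = Sig2.o1 ∧ lab (y, v) = Sig2.c1) ∨
       (lab (u, x) = Sig2.o2 ∧ lab (y, v) = Sig2.c2)) →
      FullDerives E lab (x, y) α →
      FullDerives E lab (u, v) ((u, x) :: (α ++ [(y, v)]))
  | eps (u : V) : FullDerives E lab (u, u) []

theorem isWalk_append {V : Type} {E : Set (V × V)} {u v : V} {p q : List (V × V)} :
    IsWalk E u v (p ++ q) ↔ ∃ w, IsWalk E u w p ∧ IsWalk E w v q := by
  induction p generalizing u with
  | nil => simp [IsWalk]
  | cons e p ih => simp [IsWalk, ih, and_assoc]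

theorem FullDerives.of_wrapped_labels {V : Type} {E : Set (V × V)} {lab : V × V → Sig2}
    {a b : Sig2} {l : List Sig2}
    (hab : (a = Sig2.o1 ∧ b = Sig2.c1) ∨ (a = Sig2.o2 ∧ b = Sig2.c2))
    (ih : ∀ {x y : V} {α : List (V × V)}, IsWalk E x y α → α.map lab = l →
      FullDerives E lab (x, y) α)
    {u v : V} {α : List (V × V)} (hα : IsWalk E u v α) (hl : α.map lab = a :: l ++ [b]) :
    FullDerives E lab (u, v) α := by
  obtain ⟨p, q, rfl, hp, hq⟩ := List.map_eq_append_iff.mp hl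
  obtain ⟨⟨u', x⟩, β, rfl, he, hβ⟩ := List.map_eq_cons_iff.mp hp
  obtain ⟨⟨y, v'⟩, rfl, hf⟩ := List.map_eq_singleton_iff.mp hq
  obtain ⟨heE, rfl, hwalk⟩ := hα
  obtain ⟨w, hβw, hfE, rfl, rfl⟩ := isWalk_append.mp hwalk
  exact FullDerives.wrap heE hfE (by rw [he, hf]; exact hab) (ih hβw hβ)

theorem IsDyck.fullDerives {V : Type} {E : Set (V × V)} {lab : V × V → Sig2}
    {l : List Sig2} (hl : IsDyck l) {u v : V} {α : List (V × V)}
    (hα : IsWalk E u v α) (hmap : α.map lab = l) : FullDerives E lab (u, v) α := by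
  induction hl generalizing u v α with
  | nil =>
    obtain rfl := List.map_eq_nil_iff.mp hmap
    obtain rfl : u = v := hα
    exact FullDerives.eps u
  | append _ _ ihp ihq =>
    obtain ⟨p, q, rfl, hp, hq⟩ := List.map_eq_append_iff.mp hmap
    obtain ⟨w, hpw, hqw⟩ := isWalk_append.mp hα
    exact FullDerives.split w (ihp hpw hp) (ihq hqw hq)
  | br1 _ ih => exact FullDerives.of_wrapped_labels (Or.inl ⟨rfl, rfl⟩) ih hα hmap
  | br2 _ ih => exact FullDerives.of_wrapped_labels (Or.inr ⟨rfl, rfl⟩) ih hα hmap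

/-- In the grammar with all allowed productions, every valid walk from `u` to `v`
(viewed as a word over the edge alphabet) is derivable from `⟨u,v⟩`. -/
theorem validWalk_fullDerives
    {V : Type} [Fintype V] (E : Set (V × V)) (lab : V × V → Sig2)
    (u v : V) (α : List (V × V)) (h : IsValidWalk E lab u v α) :
    FullDerives E lab (u, v) α := by
  exact h.2.fullDerives h.1 rfl
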